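/- Let P : Fin n → Finset E be a profile with loads ℓ_P, and let g : E → ℝ satisfy |g(e) − ℓ_P(e)| ≤ r for every edge e. Suppose Q is a path with c_Q(g) ≤ c_{P(i)}(g) − α for some player i and some α ≥ 0. Then, letting P' = Function.update P i Q, Rosenthal's potential decreases by at least α − 2λmr − λm: Ψ(P) − Ψ(P') ≥ α − 2·λ·m·r − λ·m. (Hence every deviation made during the simulated best-response dynamics decreases the potential by at least α − 2λmr − λm.) -/

import Mathlib

/-- The load of edge `e` under profile `P`: the number of players whose path contains `e`. -/
def congestionLoad {E : Type*} [Fintype E] [DecidableEq E] {n : ℕ}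
    (P : Fin n → Finset E) (e : E) : ℕ :=
  (Finset.univ.filter fun i => e ∈ P i).card

/-- Rosenthal's potential `Ψ(P) = Σ_e Σ_{j=1}^{ℓ_P(e)} c_e(j)` for real-valued edge cost
functions evaluated at integer loads. -/
def rosenthalPotential {E : Type*} [Fintype E] [DecidableEq E] {n : ℕ}
    (c : E → ℝ → ℝ) (P : Fin n → Finset E) : ℝ :=
  ∑ e : E, ∑ j ∈ Finset.Icc 1 (congestionLoad P e), c e (j : ℝ)

theorem load_split {E : Type*} [Fintype E] [DecidableEq E] {n : ℕ}
    (P : Fin n → Finset E) (i : Fin n) (Q : Finset E) (e : E) :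
    ∃ k : ℕ, congestionLoad P e = k + (if e ∈ P i then 1 else 0) ∧
      congestionLoad (Function.update P i Q) e = k + (if e ∈ Q then 1 else 0) := by
  refine ⟨∑ j ∈ Finset.univ.erase i, if e ∈ P j then 1 else 0, ?_, ?_⟩
  · unfold congestionLoad
    rw [Finset.card_filter, Finset.sum_erase_add _ _ (Finset.mem_univ i)]
  · unfold congestionLoad
    rw [Finset.card_filter, ← Finset.sum_erase_add _ _ (Finset.mem_univ i)]
    congr 1
    · refine Finset.sum_congr rfl fun j hj => ?_
      rw [Function.update_of_ne (Finset.ne_of_mem_erase hj)]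
    · simp

/-- **Potential decrease from a deviation found w.r.t. approximate counts.** If
`|g(e) − ℓ_P(e)| ≤ r` for all edges, each edge cost `c e` is `λ`-Lipschitz, and path `Q`
satisfies `c_Q(g) ≤ c_{P i}(g) − α`, then switching player `i` to `Q` decreases Rosenthal's
potential by at least `α − 2λmr − λm`, where `m = |E|`. -/
theorem potential_decrease_of_approx_deviation
    {E : Type*} [Fintype E] [DecidableEq E] {n : ℕ}
    (lam r α : ℝ) (hlam : 0 ≤ lam) (hr : 0 ≤ r) (hα : 0 ≤ α)
    (c : E → ℝ → ℝ) (hc : ∀ e : E, LipschitzWith lam.toNNReal (c e))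
    (P : Fin n → Finset E)
    (g : E → ℝ) (hg : ∀ e : E, |g e - (congestionLoad P e : ℝ)| ≤ r)
    (i : Fin n) (Q : Finset E)
    (hdev : (∑ e ∈ Q, c e (g e)) ≤ (∑ e ∈ P i, c e (g e)) - α) :
    rosenthalPotential c P - rosenthalPotential c (Function.update P i Q) ≥
      α - 2 * lam * (Fintype.card E : ℝ) * r - lam * (Fintype.card E : ℝ) := by
  have hL : ∀ e x y, |c e x - c e y| ≤ lam * |x - y| := by
    intro e x y
    have h := (hc e).dist_le_mul x y
    rwa [Real.dist_eq, Real.dist_eq, Real.coe_toNNReal _ hlam] at h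
  have hlr : 0 ≤ lam * r := mul_nonneg hlam hr
  have key : ∀ e : E, (if e ∈ P i then c e (g e) else 0) - (if e ∈ Q then c e (g e) else 0)
      - (2 * lam * r + lam) ≤
      (∑ j ∈ Finset.Icc 1 (congestionLoad P e), c e (j : ℝ)) -
      ∑ j ∈ Finset.Icc 1 (congestionLoad (Function.update P i Q) e), c e (j : ℝ) := by
    intro e
    obtain ⟨k, h1, h2⟩ := load_split P i Q e
    have hge := hg e
    rw [h1] at hge
    rw [h1, h2]
    by_cases hp : e ∈ P i <;> by_cases hq : e ∈ Q <;> simp only [hp, hq, if_true, if_false] at hge ⊢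
    · linarith
    · rw [Finset.sum_Icc_succ_top (by omega), add_zero]
      have h3 := (hL e (g e) ((k + 1 : ℕ) : ℝ)).trans (mul_le_mul_of_nonneg_left hge hlam)
      have h4 := (abs_le.1 h3).2
      linarith
    · rw [Finset.sum_Icc_succ_top (by omega), add_zero]
      have h5 : |g e - ((k + 1 : ℕ) : ℝ)| ≤ r + 1 := by
        rw [abs_le] at hge ⊢
        push_cast at hge ⊢
        constructor <;> linarith
      have h3 := (hL e (g e) ((k + 1 : ℕ) : ℝ)).trans (mul_le_mul_of_nonneg_left h5 hlam)
      have h4 := (abs_le.1 h3).1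
      linarith
    · linarith
  have hs := Finset.sum_le_sum fun e (_ : e ∈ Finset.univ) => key e
  simp only [Finset.sum_sub_distrib, Finset.sum_ite_mem, Finset.univ_inter, Finset.sum_const,
    Finset.card_univ, nsmul_eq_mul] at hs
  unfold rosenthalPotential
  linarith
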